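/- arXiv:2407.05793 — 2 statements merged into one kernel-verified Lean document; each statement's English description precedes it below -/
import Mathlib

section
/- Let M be an episodic loop-free MDP with finite state space X partitioned into layers X_0, ..., X_{L-1} (transitions only go from layer k to layer k+1), finite action set A, and transition function P. A vector q ∈ [0,1]^{X×A×X} is a valid occupancy measure of M (i.e., q = q^{P,π} for some policy π, where q^{P,π}(x,a,x') = Pr[x_k = x, a_k = a, x_{k+1} = x' | P, π] for x ∈ X_k) if and only if the following three conditions all hold: (1) for every layer k ∈ {0,...,L-1}, the sum of q(x,a,x') over all x ∈ X_k, a ∈ A, x' ∈ X_{k+1} equals 1; (2) for every layer k ∈ {1,...,L-1} and every state x ∈ X_k, the outgoing mass Σ_{a∈A} Σ_{x'∈X_{k+1}} q(x,a,x') equals the incoming mass Σ_{x'∈X_{k-1}} Σ_{a∈A} q(x',a,x); (3) the transition function P^q induced by q, defined by P^q(x'|x,a) = q(x,a,x') / q(x,a) where q(x,a) = Σ_{x'} q(x,a,x') (whenever q(x,a) > 0), coincides with the true transition function P. -/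
open Finset

/-- An episodic loop-free MDP: finite states partitioned into layers `0, …, L`
(the starting layer `0` is the singleton `{start}`), finite actions, and a
transition function `P` that moves mass only from layer `k` to layer `k+1`,
and is a probability distribution at every non-terminal state. -/
structure LoopFreeMDP (X A : Type) [Fintype X] [Fintype A] [DecidableEq X] where
  /-- number of transition steps; layers are indexed `0, …, L` -/
  L : ℕ
  L_pos : 0 < L
  layer : X → ℕ
  layer_le : ∀ x, layer x ≤ L
  start : X
  layer_start : layer start = 0
  start_unique : ∀ x, layer x = 0 → x = start
  P : X → A → X → ℝ
  P_nonneg : ∀ x a x', 0 ≤ P x a x'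
  P_loopfree : ∀ x a x', P x a x' ≠ 0 → layer x' = layer x + 1
  P_sum_one : ∀ x a, layer x < L → ∑ x', P x a x' = 1

/-- A (Markov) policy: a probability distribution over actions at every state. -/
def IsPolicy {X A : Type} [Fintype X] [Fintype A] (π : X → A → ℝ) : Prop :=
  (∀ x a, 0 ≤ π x a) ∧ ∀ x, ∑ a, π x a = 1

variable {X A : Type} [Fintype X] [Fintype A] [DecidableEq X]

/-- `M.stateProb π k x = Pr[x_k = x | P, π]`: the probability that the trajectory
generated by following `π` under `P` (started at `start`) visits state `x` at step `k`. -/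
def LoopFreeMDP.stateProb (M : LoopFreeMDP X A) (π : X → A → ℝ) : ℕ → X → ℝ
  | 0, x => if x = M.start then 1 else 0
  | k + 1, x' => ∑ x : X, ∑ a : A, LoopFreeMDP.stateProb M π k x * π x a * M.P x a x'

/-- The occupancy measure `q^{P,π}(x,a,x') = Pr[x_k = x, a_k = a, x_{k+1} = x' | P, π]`
where `k = layer x`. -/
def LoopFreeMDP.occupancy (M : LoopFreeMDP X A) (π : X → A → ℝ) (x : X) (a : A) (x' : X) : ℝ :=
  M.stateProb π (M.layer x) x * π x a * M.P x a x'

namespace LoopFreeMDP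

theorem P_eq_zero (M : LoopFreeMDP X A) {x x' : X} (a : A) (h : M.layer x' ≠ M.layer x + 1) :
    M.P x a x' = 0 :=
  not_not.1 fun hP => h (M.P_loopfree x a x' hP)

theorem P_eq_zero_of_layer_eq_L (M : LoopFreeMDP X A) {x : X} (a : A) (x' : X)
    (h : M.layer x = M.L) : M.P x a x' = 0 :=
  M.P_eq_zero a (by have := M.layer_le x'; omega)

theorem filter_layer_zero (M : LoopFreeMDP X A) :
    univ.filter (fun x => M.layer x = 0) = {M.start} := by
  ext x
  simp only [mem_filter, mem_univ, true_and, mem_singleton]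
  exact ⟨M.start_unique x, fun h => h ▸ M.layer_start⟩

/-- A function on states vanishing off layer `k` has the same sum over layer `k` as over
all states. -/
theorem sum_layer_eq_sum (M : LoopFreeMDP X A) {k : ℕ} {f : X → ℝ}
    (hf : ∀ x, M.layer x ≠ k → f x = 0) :
    ∑ x ∈ univ.filter (fun x => M.layer x = k), f x = ∑ x, f x :=
  sum_subset (subset_univ _) fun x _ hx => hf x (by simpa using hx)

theorem stateProb_eq_zero (M : LoopFreeMDP X A) (π : X → A → ℝ) {k : ℕ} {x : X}
    (h : M.layer x ≠ k) : M.stateProb π k x = 0 := by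
  induction k generalizing x with
  | zero =>
    rw [stateProb, if_neg]
    rintro rfl
    exact h M.layer_start
  | succ k ih =>
    refine sum_eq_zero fun y _ => sum_eq_zero fun a _ => ?_
    by_cases hy : M.layer y = k
    · rw [M.P_eq_zero a (by omega), mul_zero]
    · rw [ih hy, zero_mul, zero_mul]

/-- A state is left with the probability with which it is visited. -/
theorem sum_occupancy (M : LoopFreeMDP X A) {π : X → A → ℝ} (hπ : IsPolicy π) {x : X}
    (hx : M.layer x < M.L) :
    ∑ a, ∑ x', M.occupancy π x a x' = M.stateProb π (M.layer x) x := by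
  simp only [occupancy, ← mul_sum, M.P_sum_one x _ hx, mul_one, hπ.2 x]

theorem sum_occupancy_layer (M : LoopFreeMDP X A) (π : X → A → ℝ) (x : X) (a : A) :
    ∑ x' ∈ univ.filter (fun x' => M.layer x' = M.layer x + 1), M.occupancy π x a x'
      = ∑ x', M.occupancy π x a x' :=
  M.sum_layer_eq_sum fun x' hx' => by rw [occupancy, M.P_eq_zero a hx', mul_zero]

/-- A state of layer `k + 1` is visited with the probability with which it is entered. -/
theorem sum_occupancy_incoming (M : LoopFreeMDP X A) (π : X → A → ℝ) (k : ℕ) (x' : X) :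
    ∑ x ∈ univ.filter (fun x => M.layer x = k), ∑ a, M.occupancy π x a x'
      = M.stateProb π (k + 1) x' := by
  rw [stateProb, ← M.sum_layer_eq_sum (k := k)]
  · refine sum_congr rfl fun x hx => ?_
    simp only [mem_filter, mem_univ, true_and] at hx
    simp only [occupancy, hx]
  · intro x hx
    simp only [M.stateProb_eq_zero π hx, zero_mul, sum_const_zero]

theorem sum_stateProb (M : LoopFreeMDP X A) {π : X → A → ℝ} (hπ : IsPolicy π) {k : ℕ}
    (hk : k ≤ M.L) : ∑ x, M.stateProb π k x = 1 := by
  induction k with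
  | zero => simp [stateProb]
  | succ k ih =>
    simp only [← M.sum_occupancy_incoming]
    rw [sum_comm, ← ih (by omega), ← M.sum_layer_eq_sum fun x => M.stateProb_eq_zero π]
    refine sum_congr rfl fun x hx => ?_
    simp only [mem_filter, mem_univ, true_and] at hx
    subst hx
    rw [sum_comm, M.sum_occupancy hπ (by omega)]

/-- The policy induced by `q`: actions are weighted by the mass `q(x,a)`, and chosen
uniformly where `q` has no mass. -/
noncomputable def inducedPolicy (q : X → A → X → ℝ) (x : X) (a : A) : ℝ :=
  if ∑ b, ∑ x', q x b x' = 0 then (Fintype.card A : ℝ)⁻¹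
  else (∑ x', q x a x') / ∑ b, ∑ x', q x b x'

theorem isPolicy_inducedPolicy {X A : Type} [Fintype X] [Fintype A] [Nonempty A]
    {q : X → A → X → ℝ} (hq : ∀ x a x', 0 ≤ q x a x') :
    IsPolicy (inducedPolicy q) := by
  refine ⟨fun x a => ?_, fun x => ?_⟩
  · unfold inducedPolicy
    split_ifs
    · positivity
    · exact div_nonneg (sum_nonneg fun _ _ => hq _ _ _)
        (sum_nonneg fun _ _ => sum_nonneg fun _ _ => hq _ _ _)
  · unfold inducedPolicy
    split_ifs with h
    · simp
    · rw [← sum_div, div_self h]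

theorem mul_inducedPolicy {X A : Type} [Fintype X] [Fintype A] {q : X → A → X → ℝ}
    (hq : ∀ x a x', 0 ≤ q x a x') (x : X) (a : A) :
    (∑ b, ∑ x', q x b x') * inducedPolicy q x a = ∑ x', q x a x' := by
  unfold inducedPolicy
  split_ifs with h
  · rw [h, zero_mul]
    exact ((sum_eq_zero_iff_of_nonneg fun _ _ => sum_nonneg fun _ _ => hq _ _ _).1 h a
      (mem_univ a)).symm
  · exact mul_div_cancel₀ _ h

/-- If `q` induces the transition function `P`, then `q(x,a,x') = q(x,a) P(x'|x,a)`. -/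
theorem eq_sum_mul_P (M : LoopFreeMDP X A) {q : X → A → X → ℝ} (hq : ∀ x a x', 0 ≤ q x a x')
    (hP : ∀ x a x', 0 < ∑ x'', q x a x'' → q x a x' / (∑ x'', q x a x'') = M.P x a x')
    (x : X) (a : A) (x' : X) : q x a x' = (∑ x'', q x a x'') * M.P x a x' := by
  rcases (sum_nonneg fun x'' _ => hq x a x'' : 0 ≤ ∑ x'', q x a x'').eq_or_lt with h | h
  · rw [← h, zero_mul]
    exact (sum_eq_zero_iff_of_nonneg fun _ _ => hq _ _ _).1 h.symm x' (mem_univ x')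
  · rw [← hP x a x' h, mul_div_cancel₀ _ h.ne']

/-- Under the flow constraints, the policy induced by `q` visits each state with probability
the mass that `q` gives it. -/
theorem stateProb_inducedPolicy (M : LoopFreeMDP X A) {q : X → A → X → ℝ}
    (hq : ∀ x a x', 0 ≤ q x a x')
    (hfac : ∀ x a x', q x a x' = (∑ x'', q x a x'') * M.P x a x')
    (hstart : ∑ a, ∑ x', q M.start a x' = 1)
    (hflow : ∀ k, k + 1 < M.L → ∀ x, M.layer x = k + 1 → ∑ a, ∑ x', q x a x'
      = ∑ x' ∈ univ.filter (fun x' => M.layer x' = k), ∑ a, q x' a x)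
    {k : ℕ} (hk : k < M.L) {x : X} (hx : M.layer x = k) :
    M.stateProb (inducedPolicy q) k x = ∑ a, ∑ x', q x a x' := by
  induction k generalizing x with
  | zero => rw [M.start_unique x hx, hstart, stateProb, if_pos rfl]
  | succ k ih =>
    rw [hflow k hk x hx, ← M.sum_occupancy_incoming]
    refine sum_congr rfl fun y hy => sum_congr rfl fun a _ => ?_
    simp only [mem_filter, mem_univ, true_and] at hy
    rw [occupancy, hy, ih (by omega) hy, mul_inducedPolicy hq, ← hfac]

end LoopFreeMDP

/-- Lemma 1, validity characterization of occupancy measures: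
a vector `q ∈ [0,1]^{X×A×X}` is a valid occupancy measure of the episodic loop-free
MDP `M` (i.e. `q = q^{P,π}` for some policy `π`) if and only if
(1) for every layer `k ∈ {0,…,L-1}` the entries of `q` over `X_k × A × X_{k+1}` sum
to `1`, (2) for every layer `k ∈ {1,…,L-1}` and every `x ∈ X_k` the outgoing mass of
`q` at `x` equals its incoming mass, and (3) the transition function `P^q` induced by
`q` (defined by `P^q(x'|x,a) = q(x,a,x')/q(x,a)` with `q(x,a) = Σ_{x'} q(x,a,x')`,
whenever `q(x,a) > 0`) coincides with `P`. -/
theorem valid_occupancy_iff (M : LoopFreeMDP X A) (q : X → A → X → ℝ)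
    (hq : ∀ x a x', q x a x' ∈ Set.Icc (0 : ℝ) 1) :
    (∃ π : X → A → ℝ, IsPolicy π ∧ ∀ (x : X) (a : A) (x' : X),
        q x a x' = M.occupancy π x a x')
    ↔ ((∀ k, k < M.L →
          ∑ x ∈ univ.filter (fun x => M.layer x = k), ∑ a : A,
            ∑ x' ∈ univ.filter (fun x' => M.layer x' = k + 1), q x a x' = 1)
      ∧ (∀ k, 1 ≤ k → k < M.L → ∀ x : X, M.layer x = k →
          ∑ a : A, ∑ x' ∈ univ.filter (fun x' => M.layer x' = k + 1), q x a x'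
            = ∑ x' ∈ univ.filter (fun x' => M.layer x' = k - 1), ∑ a : A, q x' a x)
      ∧ (∀ (x : X) (a : A) (x' : X), 0 < ∑ x'' : X, q x a x'' →
          q x a x' / (∑ x'' : X, q x a x'') = M.P x a x')) := by
  constructor
  · rintro ⟨π, hπ, h⟩
    simp only [h]
    refine ⟨fun k hk => ?_, fun k hk₁ hk x hx => ?_, fun x a x' hpos => ?_⟩
    · rw [← M.sum_stateProb hπ hk.le, ← M.sum_layer_eq_sum fun x => M.stateProb_eq_zero π]
      refine sum_congr rfl fun x hx => ?_
      simp only [mem_filter, mem_univ, true_and] at hx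
      subst hx
      simp only [M.sum_occupancy_layer, M.sum_occupancy hπ hk]
    · subst hx
      simp only [M.sum_occupancy_layer, M.sum_occupancy hπ hk, M.sum_occupancy_incoming]
      rw [Nat.sub_add_cancel hk₁]
    · have hx : M.layer x < M.L := (M.layer_le x).lt_of_ne fun hx => by
        simp [LoopFreeMDP.occupancy, M.P_eq_zero_of_layer_eq_L a _ hx] at hpos
      simp only [LoopFreeMDP.occupancy, ← mul_sum, M.P_sum_one x a hx, mul_one] at hpos ⊢
      exact mul_div_cancel_left₀ _ hpos.ne'
  · rintro ⟨hsum, hflow, hP⟩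
    have hq₀ : ∀ x a x', 0 ≤ q x a x' := fun x a x' => (hq x a x').1
    have hfac := M.eq_sum_mul_P hq₀ hP
    have hlayer : ∀ x a, ∑ x' ∈ univ.filter (fun x' => M.layer x' = M.layer x + 1), q x a x'
        = ∑ x', q x a x' := fun x a =>
      M.sum_layer_eq_sum fun x' hx' => by rw [hfac, M.P_eq_zero a hx', mul_zero]
    have hstart : ∑ a, ∑ x', q M.start a x' = 1 := by
      have h := hsum 0 M.L_pos
      rw [M.filter_layer_zero, sum_singleton, ← M.layer_start] at h
      simpa only [hlayer] using h
    have : Nonempty A := by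
      by_contra hA
      rw [not_nonempty_iff] at hA
      simp at hstart
    refine ⟨LoopFreeMDP.inducedPolicy q, LoopFreeMDP.isPolicy_inducedPolicy hq₀,
      fun x a x' => ?_⟩
    rcases (M.layer_le x).eq_or_lt with hx | hx
    · rw [LoopFreeMDP.occupancy, hfac, M.P_eq_zero_of_layer_eq_L a x' hx, mul_zero, mul_zero]
    · rw [LoopFreeMDP.occupancy, M.stateProb_inducedPolicy hq₀ hfac hstart _ hx rfl,
        LoopFreeMDP.mul_inducedPolicy hq₀, ← hfac]
      intro k hk y hy
      have h := hflow (k + 1) (by omega) hk y hy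
      rw [← hy] at h
      simp only [hlayer] at h
      rw [h, hy, Nat.add_sub_cancel]
end

section
/- Let M be an episodic loop-free MDP with layers X_0,...,X_{L-1}, action set A, and transition function P. Suppose q ∈ [0,1]^{X×A×X} satisfies: (1) for every layer k ∈ {0,...,L-1}, Σ_{x∈X_k} Σ_{a∈A} Σ_{x'∈X_{k+1}} q(x,a,x') = 1; (2) for every k ∈ {1,...,L-1} and every x ∈ X_k, Σ_{a∈A} Σ_{x'∈X_{k+1}} q(x,a,x') = Σ_{x'∈X_{k-1}} Σ_{a∈A} q(x',a,x); and (3) for every (x,a,x') with q(x,a) > 0, q(x,a,x')/q(x,a) = P(x'|x,a). Then q is a valid occupancy measure: letting π^q be any policy with π^q(a|x) = q(x,a)/q(x) at every state x with q(x) > 0, one has q = q^{P,π^q}, i.e., q(x,a,x') = Pr[x_k = x, a_k = a, x_{k+1} = x' | P, π^q] for every x ∈ X_k, a ∈ A, x' ∈ X_{k+1}. -/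
open Finset

variable {X A : Type} [Fintype X] [Fintype A] [DecidableEq X]

/-- A nonnegative `q` whose induced transition function agrees with `P` factors as
`q(x,a,x') = q(x,a) P(x'|x,a)`. -/
theorem LoopFreeMDP.eq_sum_mul_P_s5 (M : LoopFreeMDP X A) {q : X → A → X → ℝ}
    (hq : ∀ x a x', 0 ≤ q x a x')
    (hP : ∀ (x : X) (a : A) (x' : X), 0 < ∑ x'' : X, q x a x'' →
      q x a x' / (∑ x'' : X, q x a x'') = M.P x a x')
    (x : X) (a : A) (x' : X) : q x a x' = (∑ x'' : X, q x a x'') * M.P x a x' := by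
  rcases (sum_nonneg fun x'' _ => hq x a x'').eq_or_lt' with h | h
  · rw [h, zero_mul]
    exact (sum_eq_zero_iff_of_nonneg fun x'' _ => hq x a x'').1 h x' (mem_univ _)
  · rw [← hP x a x' h, mul_div_cancel₀ _ h.ne']

/-- A policy induced by a nonnegative `q` satisfies `q(x) π(a|x) = q(x,a)`. -/
theorem sum_mul_induced_policy {S B : Type} [Fintype S] [Fintype B]
    {q : S → B → S → ℝ} (hq : ∀ x a x', 0 ≤ q x a x')
    {π : S → B → ℝ}
    (hπ : ∀ (x : S) (a : B), 0 < ∑ b : B, ∑ x'' : S, q x b x'' →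
      π x a = (∑ x'' : S, q x a x'') / (∑ b : B, ∑ x'' : S, q x b x''))
    (x : S) (a : B) :
    (∑ b : B, ∑ x'' : S, q x b x'') * π x a = ∑ x'' : S, q x a x'' := by
  have hnonneg : ∀ b ∈ (univ : Finset B), 0 ≤ ∑ x'' : S, q x b x'' :=
    fun b _ => sum_nonneg fun x'' _ => hq x b x''
  rcases (sum_nonneg hnonneg).eq_or_lt' with h | h
  · rw [h, zero_mul]
    exact ((sum_eq_zero_iff_of_nonneg hnonneg).1 h a (mem_univ _)).symm
  · rw [hπ x a h, mul_div_cancel₀ _ h.ne']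

/-- sufficiency of the three conditions: if `q ∈ [0,1]^{X×A×X}`
satisfies (1) per-layer normalization, (2) flow conservation, and (3) consistency of
its induced transition function with `P`, then `q` is a valid occupancy measure:
for any policy `π^q` with `π^q(a|x) = q(x,a)/q(x)` at every state with `q(x) > 0`,
one has `q(x,a,x') = q^{P,π^q}(x,a,x')` for every `x ∈ X_k`, `a ∈ A`, `x' ∈ X_{k+1}`. -/
theorem valid_occupancy_of_conditions (M : LoopFreeMDP X A) (q : X → A → X → ℝ)
    (hq : ∀ x a x', q x a x' ∈ Set.Icc (0 : ℝ) 1)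
    (h1 : ∀ k, k < M.L →
      ∑ x ∈ univ.filter (fun x => M.layer x = k), ∑ a : A,
        ∑ x' ∈ univ.filter (fun x' => M.layer x' = k + 1), q x a x' = 1)
    (h2 : ∀ k, 1 ≤ k → k < M.L → ∀ x : X, M.layer x = k →
      ∑ a : A, ∑ x' ∈ univ.filter (fun x' => M.layer x' = k + 1), q x a x'
        = ∑ x' ∈ univ.filter (fun x' => M.layer x' = k - 1), ∑ a : A, q x' a x)
    (h3 : ∀ (x : X) (a : A) (x' : X), 0 < ∑ x'' : X, q x a x'' →
      q x a x' / (∑ x'' : X, q x a x'') = M.P x a x')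
    (π : X → A → ℝ) (hπ : IsPolicy π)
    (hπq : ∀ (x : X) (a : A), 0 < ∑ b : A, ∑ x'' : X, q x b x'' →
      π x a = (∑ x'' : X, q x a x'') / (∑ b : A, ∑ x'' : X, q x b x'')) :
    ∀ (x : X) (a : A) (x' : X), M.layer x' = M.layer x + 1 →
      q x a x' = M.occupancy π x a x' := by
  have hq0 : ∀ x a x', 0 ≤ q x a x' := fun x a x' => (hq x a x').1
  have hfac := M.eq_sum_mul_P_s5 hq0 h3
  have hpol := sum_mul_induced_policy hq0 hπq
  have hP_off : ∀ x a x', M.layer x' ≠ M.layer x + 1 → M.P x a x' = 0 := fun x a x' h =>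
    by_contra fun hne => h (M.P_loopfree x a x' hne)
  have hq_off : ∀ x a x', M.layer x' ≠ M.layer x + 1 → q x a x' = 0 := fun x a x' h => by
    rw [hfac, hP_off x a x' h, mul_zero]
  have hout : ∀ x a, ∑ x' ∈ univ.filter (fun x' => M.layer x' = M.layer x + 1), q x a x'
      = ∑ x', q x a x' := fun x a =>
    sum_filter_of_ne fun x' _ hne => by_contra fun h => hne (hq_off x a x' h)
  have hstate : ∀ k, k < M.L → ∀ x, M.layer x = k →
      M.stateProb π k x = ∑ b : A, ∑ x'' : X, q x b x'' := by
    intro k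
    induction k with
    | zero =>
      intro hk x hx
      have hlayer : univ.filter (fun y => M.layer y = 0) = {x} := by
        ext y
        simp only [mem_filter, mem_univ, true_and, mem_singleton]
        exact ⟨fun hy => (M.start_unique y hy).trans (M.start_unique x hx).symm,
          fun hy => hy ▸ hx⟩
      have hnorm := h1 0 hk
      rw [hlayer, sum_singleton, ← hx] at hnorm
      simp only [hout] at hnorm
      rw [hnorm, LoopFreeMDP.stateProb, if_pos (M.start_unique x hx)]
    | succ k ih =>
      intro hk x' hx'
      have hflow := h2 (k + 1) (Nat.le_add_left 1 k) hk x' hx'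
      rw [Nat.add_sub_cancel, ← hx'] at hflow
      simp only [hout] at hflow
      rw [hflow, LoopFreeMDP.stateProb, sum_filter]
      refine sum_congr rfl fun x _ => ?_
      split_ifs with hx
      · refine sum_congr rfl fun a _ => ?_
        rw [ih (by omega) x hx, hpol, ← hfac]
      · refine sum_eq_zero fun a _ => ?_
        rw [hP_off x a x' (by omega), mul_zero]
  intro x a x' hx'
  have hlt : M.layer x < M.L := by
    have := M.layer_le x'
    omega
  rw [LoopFreeMDP.occupancy, hstate _ hlt x rfl, hpol, ← hfac]
end
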